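/- Let 0 < a < 1/2 and let x₁ = √((1-2a)/(1+2a)). Then x₁ ∈ [0,1], f(x₁) = M_R, and f(x) ≤ M_R for all x ∈ [0,1]; that is, f attains its global maximum M_R on the interval [0,1] at x₁. -/

import Mathlib

/-- On `[0,1]`, `t ↦ t ^ p * (1 - t) ^ q` is bounded by its value at `t = p / (p + q)`. -/
theorem rpow_mul_one_sub_rpow_le {p q t : ℝ} (hp : 0 < p) (hq : 0 < q) (ht0 : 0 ≤ t)
    (ht1 : t ≤ 1) :
    t ^ p * (1 - t) ^ q ≤ (p / (p + q)) ^ p * (q / (p + q)) ^ q := by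
  have hs : 0 < p + q := add_pos hp hq
  have ht : 0 ≤ 1 - t := sub_nonneg.2 ht1
  set c := p / (p + q) with hc
  set d := q / (p + q) with hd
  have hc0 : 0 < c := div_pos hp hs
  have hd0 : 0 < d := div_pos hq hs
  have hu : 0 ≤ t / c := div_nonneg ht0 hc0.le
  have hv : 0 ≤ (1 - t) / d := div_nonneg ht hd0.le
  have amgm := Real.geom_mean_le_arith_mean2_weighted hc0.le hd0.le hu hv
    (by rw [hc, hd]; field_simp)
  rw [mul_div_cancel₀ _ hc0.ne', mul_div_cancel₀ _ hd0.ne', add_sub_cancel] at amgm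
  have hpow := Real.rpow_le_one (by positivity) amgm hs.le
  rw [Real.mul_rpow (by positivity) (by positivity), ← Real.rpow_mul hu, ← Real.rpow_mul hv,
    hc, hd, div_mul_cancel₀ _ hs.ne', div_mul_cancel₀ _ hs.ne', ← hc, ← hd,
    Real.div_rpow ht0 hc0.le, Real.div_rpow ht hd0.le, div_mul_div_comm] at hpow
  exact (div_le_one (by positivity)).1 hpow

/-- For `0 < a < 1/2` and `x₁ = √((1-2a)/(1+2a))`, the function
`f(x) = |x|^(1/2-a)·|1-x²|^a` attains its global maximum
`M_R = (4a)^a·(1-2a)^(1/4-a/2)·(1+2a)^(-1/4-a/2)` on `[0,1]` at `x₁`. -/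
theorem max_on_unit_interval (a : ℝ) (ha0 : 0 < a) (ha : a < 1 / 2)
    (x₁ : ℝ) (hx₁ : x₁ = Real.sqrt ((1 - 2 * a) / (1 + 2 * a)))
    (f : ℝ → ℝ) (hf : f = fun x => |x| ^ (1 / 2 - a) * |1 - x ^ 2| ^ a)
    (MR : ℝ)
    (hMR : MR = (4 * a) ^ a * (1 - 2 * a) ^ (1 / 4 - a / 2) * (1 + 2 * a) ^ (-(1 / 4) - a / 2)) :
    x₁ ∈ Set.Icc (0 : ℝ) 1 ∧ f x₁ = MR ∧ ∀ x ∈ Set.Icc (0 : ℝ) 1, f x ≤ MR := by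
  have hm : 0 < 1 - 2 * a := by linarith
  have hpl : 0 < 1 + 2 * a := by linarith
  have hc0 : 0 ≤ (1 - 2 * a) / (1 + 2 * a) := by positivity
  have hc1 : (1 - 2 * a) / (1 + 2 * a) ≤ 1 := (div_le_one hpl).2 (by linarith)
  have hf' : ∀ x ∈ Set.Icc (0 : ℝ) 1,
      f x = (x ^ 2) ^ (1 / 4 - a / 2) * (1 - x ^ 2) ^ a := by
    rintro x ⟨h0, h1⟩
    have hx2 : 0 ≤ 1 - x ^ 2 := by nlinarith
    rw [hf]
    simp only
    rw [abs_of_nonneg h0, abs_of_nonneg hx2, ← Real.rpow_natCast_mul h0]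
    congr 2
    push_cast
    ring
  have hMR' : MR =
      ((1 - 2 * a) / (1 + 2 * a)) ^ (1 / 4 - a / 2) * (4 * a / (1 + 2 * a)) ^ a := by
    rw [hMR, Real.div_rpow hm.le hpl.le, Real.div_rpow (by positivity) hpl.le, div_mul_div_comm,
      ← Real.rpow_add hpl, show -(1 / 4) - a / 2 = -(1 / 4 - a / 2 + a) by ring,
      Real.rpow_neg hpl.le]
    ring
  have hmem : x₁ ∈ Set.Icc (0 : ℝ) 1 :=
    hx₁ ▸ ⟨Real.sqrt_nonneg _, Real.sqrt_le_one.2 hc1⟩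
  refine ⟨hmem, ?_, fun x hx => ?_⟩
  · rw [hf' x₁ hmem, hMR', hx₁, Real.sq_sqrt hc0]
    congr 2
    field_simp
    ring
  · rw [hf' x hx, hMR']
    have key := rpow_mul_one_sub_rpow_le (p := 1 / 4 - a / 2) (by linarith) ha0
      (sq_nonneg x) (pow_le_one₀ hx.1 hx.2)
    have hsum : 1 / 4 - a / 2 + a = (1 + 2 * a) / 4 := by ring
    have hc : (1 / 4 - a / 2) / (1 / 4 - a / 2 + a) = (1 - 2 * a) / (1 + 2 * a) := by
      rw [hsum]; field_simp; ring
    have hd : a / (1 / 4 - a / 2 + a) = 4 * a / (1 + 2 * a) := by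
      rw [hsum]; field_simp
    rwa [hc, hd] at key
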